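/- For all a, b, a', b' in the finite field F = GF(3^5), the map ψ_{a,b} of F^4 sending (u, t, r, s) to (u, t + h_{(a,b)}(r,s) − g_{(a,b)}(u), r − u·a, s − u·b) maps the set E(a',b') = { (t, −g_{(a',b')}(t), −a'·t, −b'·t) : t ∈ F } onto the set E(a'+a, b'+b) = { (t, −g_{(a'+a,b'+b)}(t), −(a'+a)·t, −(b'+b)·t) : t ∈ F }; that is, the image of E(a',b') under ψ_{a,b} equals E(a'+a, b'+b). (The collineation ψ_{a,b} fixes E_∞ pointwise and translates the elements of the dual Penttila–Williams egg.) -/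

import Mathlib

/-- `F = GF(3^5)`, the finite field with `3^5 = 243` elements. -/
abbrev F : Type := GaloisField 3 5

/-- `g_{(a,b)}(t) = a^2*t - (b^2)^9*t^9 + (a*b)^81*t^81`. -/
noncomputable def g (a b t : F) : F :=
  a ^ 2 * t - (b ^ 2) ^ 9 * t ^ 9 + (a * b) ^ 81 * t ^ 81

/-- `h_{(a,b)}(r,s) = -a*r + b^9*s^9 + (b*r + a*s)^81`. -/
noncomputable def h (a b r s : F) : F :=
  -a * r + b ^ 9 * s ^ 9 + (b * r + a * s) ^ 81

/-- The collineation `ψ_{a,b} : (u,t,r,s) ↦ (u, t + h_{(a,b)}(r,s) - g_{(a,b)}(u),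
r - u*a, s - u*b)`. -/
noncomputable def psi (a b : F) (p : F × F × F × F) : F × F × F × F :=
  (p.1, p.2.1 + h a b p.2.2.1 p.2.2.2 - g a b p.1,
    p.2.2.1 - p.1 * a, p.2.2.2 - p.1 * b)

theorem add_pow_nine (x y : F) : (x + y) ^ 9 = x ^ 9 + y ^ 9 :=
  add_pow_char_pow (p := 3) (n := 2) x y

theorem add_pow_eighty_one (x y : F) : (x + y) ^ 81 = x ^ 81 + y ^ 81 :=
  add_pow_char_pow (p := 3) (n := 4) x y

theorem h_sub_g (a b a' b' t : F) :
    -g a' b' t + h a b (-(a' * t)) (-(b' * t)) - g a b t = -g (a' + a) (b' + b) t := by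
  have three : (3 : F) = 0 := CharP.cast_eq_zero F 3
  have sq : (b' + b) ^ 2 = b' ^ 2 + b ^ 2 + -(b * b') := by
    linear_combination (b * b') * three
  have mul : (a' + a) * (b' + b) = a' * b' + a * b + (b * a' + a * b') := by ring
  have lin : b * -(a' * t) + a * -(b' * t) = -((b * a' + a * b') * t) := by ring
  have odd (x : F) : (-x) ^ 81 = -x ^ 81 := Odd.neg_pow (by decide) x
  unfold g h
  rw [sq, mul, lin, odd, mul_pow _ t 81]
  simp only [add_pow_nine, add_pow_eighty_one (_ + _) (b * a' + a * b'),
    add_pow_eighty_one (a' * b')]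
  generalize (b * a' + a * b') ^ 81 = w
  linear_combination (a * a' * t) * three

/-- `ψ_{a,b}` maps the egg element `E(a',b')` of the dual Penttila–Williams egg
onto `E(a'+a, b'+b)`. -/
theorem psi_maps_egg_elements (a b a' b' : F) :
    psi a b '' {p : F × F × F × F | ∃ t : F,
        p = (t, -g a' b' t, -(a' * t), -(b' * t))} =
    {p : F × F × F × F | ∃ t : F,
        p = (t, -g (a' + a) (b' + b) t, -((a' + a) * t), -((b' + b) * t))} := by
  have image_point (t : F) : psi a b (t, -g a' b' t, -(a' * t), -(b' * t)) =
      (t, -g (a' + a) (b' + b) t, -((a' + a) * t), -((b' + b) * t)) := by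
    simp only [psi, h_sub_g, Prod.mk.injEq, true_and]
    constructor <;> ring
  ext p
  constructor
  · rintro ⟨_, ⟨t, rfl⟩, rfl⟩
    exact ⟨t, image_point t⟩
  · rintro ⟨t, rfl⟩
    exact ⟨_, ⟨t, rfl⟩, image_point t⟩
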